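/- arXiv:2406.05609 — 2 statements merged into one kernel-verified Lean document; each statement's English description precedes it below -/
import Mathlib

section
/- Let n ≥ 3 be an odd integer. Then λ(K⁺_{(n+1)/2,(n−1)/2}) is the largest real root of the polynomial g(x) = x³ − x² + ((1 − n²)/4)x + n²/4 − n + 3/4. -/
open Matrix

/-- The spectral radius of a finite simple graph: the largest eigenvalue of its
adjacency matrix (as a real symmetric matrix), expressed as the supremum of the
set of eigenvalues of the associated linear endomorphism. -/
noncomputable def specRad {V : Type*} [Fintype V] (G : SimpleGraph V) : ℝ :=
  letI := Classical.decEq V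
  letI := Classical.decRel G.Adj
  sSup {μ : ℝ | Module.End.HasEigenvalue (Matrix.toLin' (SimpleGraph.adjMatrix ℝ G)) μ}

/-- The number of triangles (3-cliques) of a finite simple graph. -/
noncomputable def triangleCount {V : Type*} [Fintype V] (G : SimpleGraph V) : ℕ :=
  letI := Classical.decEq V
  letI := Classical.decRel G.Adj
  (G.cliqueFinset 3).card

/-- The graph on `Fin n` obtained from the complete bipartite graph with parts
`{0, …, a-1}` and `{a, …, n-1}` by adding the extra edge `{0, 1}` inside the
first part. -/
def KbipPlus (n a : ℕ) : SimpleGraph (Fin n) :=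
  SimpleGraph.fromRel (fun u v => ((u : ℕ) < a ∧ a ≤ (v : ℕ)) ∨ ((u : ℕ) = 0 ∧ (v : ℕ) = 1))

/-- `K⁺_{⌈n/2⌉,⌊n/2⌋}`: the complete bipartite graph with parts of sizes `⌈n/2⌉`
and `⌊n/2⌋` together with one extra edge inside the part of size `⌈n/2⌉`
(added between vertices `0` and `1`). -/
def Kplus (n : ℕ) : SimpleGraph (Fin n) := KbipPlus n ((n + 1) / 2)

/-- `K^{+|}`: the graph on `Fin n` obtained from the complete bipartite graph with
parts `{0, …, a-1}` and `{a, …, n-1}` by adding the edge `e₁ = {0, 1}` inside the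
first part and deleting the cross edge `e₂ = {0, a}`, which shares the endpoint `0`
with `e₁`. -/
def KbipPlusMinus (n a : ℕ) : SimpleGraph (Fin n) :=
  SimpleGraph.fromRel (fun u v =>
    (((u : ℕ) < a ∧ a ≤ (v : ℕ)) ∧ ¬((u : ℕ) = 0 ∧ (v : ℕ) = a)) ∨
      ((u : ℕ) = 0 ∧ (v : ℕ) = 1))

/-- If the adjacency operator of `G` has an everywhere positive eigenvector `w` with
eigenvalue `r`, then `r` bounds every eigenvalue of `G`, so that `specRad G = r`. -/
theorem specRad_eq_of_pos_eigenvector {V : Type*} [Fintype V] [Nonempty V]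
    (G : SimpleGraph V) [DecidableRel G.Adj] (w : V → ℝ) (r : ℝ) (hw : ∀ i, 0 < w i)
    (h : ∀ i, ∑ j, (if G.Adj i j then w j else 0) = r * w i) : specRad G = r := by
  classical
  have key (v : V → ℝ) (i : V) :
      Matrix.toLin' (SimpleGraph.adjMatrix ℝ G) v i = ∑ j, if G.Adj i j then v j else 0 := by
    simp [Matrix.toLin'_apply, Matrix.mulVec, dotProduct, SimpleGraph.adjMatrix_apply]
  have hgreatest : IsGreatest
      {μ : ℝ | Module.End.HasEigenvalue (Matrix.toLin' (SimpleGraph.adjMatrix ℝ G)) μ} r := by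
    constructor
    · refine Module.End.hasEigenvalue_of_hasEigenvector (x := w) ⟨?_, ?_⟩
      · rw [Module.End.mem_eigenspace_iff]
        ext i
        rw [key, h]
        rfl
      · intro h0
        obtain ⟨i⟩ := ‹Nonempty V›
        exact (hw i).ne' (congrFun h0 i)
    · intro μ hμ
      obtain ⟨v, hv⟩ := hμ.exists_hasEigenvector
      have hv1 (i : V) : ∑ j, (if G.Adj i j then v j else 0) = μ * v i := by
        rw [← key, hv.apply_eq_smul]
        rfl
      obtain ⟨i, hi⟩ := Finite.exists_max fun i => |v i| / w i
      have hle (j : V) : |v j| ≤ |v i| / w i * w j := (div_le_iff₀ (hw j)).1 (hi j)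
      have hvi : 0 < |v i| := by
        refine abs_pos.2 fun h0 => hv.2 (funext fun j => ?_)
        simpa [h0] using hle j
      have hmul : |μ| * |v i| ≤ r * |v i| := by
        calc |μ| * |v i| = |∑ j, if G.Adj i j then v j else 0| := by rw [hv1, abs_mul]
          _ ≤ ∑ j, |if G.Adj i j then v j else 0| := Finset.abs_sum_le_sum_abs _ _
          _ ≤ ∑ j, |v i| / w i * (if G.Adj i j then w j else 0) := by
              refine Finset.sum_le_sum fun j _ => ?_
              split_ifs
              · exact hle j
              · simp
          _ = r * |v i| := by
              rw [← Finset.mul_sum, h]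
              field_simp [(hw i).ne']
      exact (le_abs_self μ).trans (le_of_mul_le_mul_right hmul hvi)
  rw [← hgreatest.csSup_eq, specRad]
  congr!

/-- Adjacency in `K⁺` with parts of sizes `m + 2` and `m + 1`. -/
theorem Kplus_adj_iff (m : ℕ) (i j : Fin (2 + m + (m + 1))) :
    (Kplus (2 + m + (m + 1))).Adj i j ↔
      (((i : ℕ) < m + 2 ∧ m + 2 ≤ (j : ℕ)) ∨ ((j : ℕ) < m + 2 ∧ m + 2 ≤ (i : ℕ)) ∨
        ((i : ℕ) = 0 ∧ (j : ℕ) = 1) ∨ ((i : ℕ) = 1 ∧ (j : ℕ) = 0)) := by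
  have ha : (2 + m + (m + 1) + 1) / 2 = m + 2 := by omega
  simp only [Kplus, KbipPlus, SimpleGraph.fromRel_adj, ha, ne_eq, Fin.ext_iff]
  omega

/-- Any root `r > 1` of the characteristic cubic of the quotient matrix is the spectral radius
of `K⁺` with parts of sizes `m + 2` and `m + 1`. -/
theorem specRad_Kplus_eq_of_root (m : ℕ) (r : ℝ) (hr : 1 < r)
    (hroot : r ^ 3 - r ^ 2 - (m + 2) * (m + 1) * r + m * (m + 1) = 0) :
    specRad (Kplus (2 + m + (m + 1))) = r := by
  classical
  have hr0 : 0 < r := by linarith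
  have hr1 : 0 < r - 1 := by linarith
  let f : ℕ → ℝ := fun i =>
    if i < 2 then (m + 1) / (r - 1) else if i < m + 2 then (m + 1) / r else 1
  have : Nonempty (Fin (2 + m + (m + 1))) := ⟨⟨0, by omega⟩⟩
  have hdec : DecidableRel (Kplus (2 + m + (m + 1))).Adj := Classical.decRel _
  refine specRad_eq_of_pos_eigenvector (Kplus (2 + m + (m + 1)))
    (fun i : Fin (2 + m + (m + 1)) => f i) r (fun i => ?_) fun i => ?_
  · dsimp only [f]
    split_ifs <;> positivity
  · simp only [Kplus_adj_iff]
    rw [Fin.sum_univ_eq_sum_range (fun j => if ((i : ℕ) < m + 2 ∧ m + 2 ≤ j) ∨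
      (j < m + 2 ∧ m + 2 ≤ (i : ℕ)) ∨ ((i : ℕ) = 0 ∧ j = 1) ∨ ((i : ℕ) = 1 ∧ j = 0)
      then f j else 0), Finset.sum_range_add, Finset.sum_range_add]
    have hmid : ∀ x ∈ Finset.range m, f (2 + x) = (m + 1) / r := by
      intro x hx
      have := Finset.mem_range.1 hx
      simp only [f]
      rw [if_neg (by omega), if_pos (by omega)]
    have hlast (x : ℕ) : f (2 + m + x) = 1 := by
      simp only [f]
      rw [if_neg (by omega), if_neg (by omega)]
    have h0 : f 0 = (m + 1) / (r - 1) := by simp [f]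
    have h1 : f 1 = (m + 1) / (r - 1) := by simp [f]
    obtain ⟨i, hi⟩ := i
    simp only
    by_cases hi2 : i < m + 2
    · have hM : ∀ x ∈ Finset.range m, (if (i < m + 2 ∧ m + 2 ≤ 2 + x) ∨
          (2 + x < m + 2 ∧ m + 2 ≤ i) ∨ (i = 0 ∧ 2 + x = 1) ∨ (i = 1 ∧ 2 + x = 0)
          then f (2 + x) else 0) = 0 := by
        intro x hx
        have := Finset.mem_range.1 hx
        rw [if_neg (by omega)]
      have hL : ∀ x ∈ Finset.range (m + 1), (if (i < m + 2 ∧ m + 2 ≤ 2 + m + x) ∨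
          (2 + m + x < m + 2 ∧ m + 2 ≤ i) ∨ (i = 0 ∧ 2 + m + x = 1) ∨ (i = 1 ∧ 2 + m + x = 0)
          then f (2 + m + x) else 0) = 1 := by
        intro x _
        rw [if_pos (by omega), hlast]
      rw [Finset.sum_congr rfl hM, Finset.sum_congr rfl hL, Finset.sum_range_succ,
        Finset.sum_range_one]
      by_cases hi0 : i < 2
      · have hfi : f i = (m + 1) / (r - 1) := if_pos hi0
        rw [hfi]
        interval_cases i
        · simp [h1]
          field_simp
          ring
        · simp [h0]
          field_simp
          ring
      · have hfi : f i = (m + 1) / r := (if_neg hi0).trans (if_pos hi2)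
        rw [hfi, if_neg (by omega), if_neg (by omega)]
        simp
        field_simp
    · have hM : ∀ x ∈ Finset.range m, (if (i < m + 2 ∧ m + 2 ≤ 2 + x) ∨
          (2 + x < m + 2 ∧ m + 2 ≤ i) ∨ (i = 0 ∧ 2 + x = 1) ∨ (i = 1 ∧ 2 + x = 0)
          then f (2 + x) else 0) = (m + 1) / r := by
        intro x hx
        have := Finset.mem_range.1 hx
        rw [if_pos (by omega), hmid x hx]
      have hL : ∀ x ∈ Finset.range (m + 1), (if (i < m + 2 ∧ m + 2 ≤ 2 + m + x) ∨
          (2 + m + x < m + 2 ∧ m + 2 ≤ i) ∨ (i = 0 ∧ 2 + m + x = 1) ∨ (i = 1 ∧ 2 + m + x = 0)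
          then f (2 + m + x) else 0) = 0 := by
        intro x _
        rw [if_neg (by omega)]
      have hfi : f i = 1 := by
        simp only [f]
        rw [if_neg (by omega), if_neg hi2]
      rw [Finset.sum_congr rfl hM, Finset.sum_congr rfl hL, Finset.sum_range_succ,
        Finset.sum_range_one, hfi, if_pos (by omega), if_pos (by omega), h0, h1]
      simp
      field_simp
      linarith

/-- For odd `n ≥ 3`, `λ(K⁺_{(n+1)/2,(n−1)/2})` is the largest real root of
`g(x) = x³ − x² + ((1 − n²)/4)x + n²/4 − n + 3/4`. -/
theorem specRad_Kplus_odd_root (n : ℕ) (hn : 3 ≤ n) (ho : Odd n) :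
    (specRad (Kplus n)) ^ 3 - (specRad (Kplus n)) ^ 2
        + ((1 - (n : ℝ) ^ 2) / 4) * specRad (Kplus n)
        + (n : ℝ) ^ 2 / 4 - (n : ℝ) + 3 / 4 = 0 ∧
      ∀ x : ℝ, x ^ 3 - x ^ 2 + ((1 - (n : ℝ) ^ 2) / 4) * x
          + (n : ℝ) ^ 2 / 4 - (n : ℝ) + 3 / 4 = 0 →
        x ≤ specRad (Kplus n) := by
  obtain ⟨m, rfl⟩ : ∃ m, n = 2 + m + (m + 1) := by
    obtain ⟨k, rfl⟩ := ho
    exact ⟨k - 1, by omega⟩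
  have hpoly (x : ℝ) : x ^ 3 - x ^ 2 + ((1 - ((2 + m + (m + 1) : ℕ) : ℝ) ^ 2) / 4) * x
      + ((2 + m + (m + 1) : ℕ) : ℝ) ^ 2 / 4 - ((2 + m + (m + 1) : ℕ) : ℝ) + 3 / 4
      = x ^ 3 - x ^ 2 - (m + 2) * (m + 1) * x + m * (m + 1) := by
    push_cast
    ring
  simp only [hpoly]
  have hm : (0 : ℝ) ≤ m := m.cast_nonneg
  obtain ⟨r, hr, hroot⟩ : ∃ r : ℝ, 1 < r ∧
      r ^ 3 - r ^ 2 - (m + 2) * (m + 1) * r + m * (m + 1) = 0 := by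
    have hcont : ContinuousOn
        (fun x : ℝ => x ^ 3 - x ^ 2 - (m + 2) * (m + 1) * x + m * (m + 1))
        (Set.Icc 1 (m + 3)) := by fun_prop
    obtain ⟨r, hr, hroot⟩ := intermediate_value_Ioo (by linarith) hcont
      (show (0 : ℝ) ∈ Set.Ioo _ _ by constructor <;> nlinarith [pow_nonneg hm 3])
    exact ⟨r, hr.1, hroot⟩
  have hspec := specRad_Kplus_eq_of_root m r hr hroot
  refine ⟨by rw [hspec, hroot], fun x hx => ?_⟩
  rcases le_or_gt x 1 with hx1 | hx1
  · rw [hspec]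
    linarith
  · exact (specRad_Kplus_eq_of_root m x hx1 hx).ge
end

section
/- If n ≥ 4 is even, then λ(K⁺_{⌈n/2⌉,⌊n/2⌋}) > n/2 + 2/n; if n ≥ 5 is odd, then λ(K⁺_{⌈n/2⌉,⌊n/2⌋}) > n/2 + 3/(2n). -/
open Matrix

/-- An eigenvalue of the adjacency matrix, exhibited by a nonzero eigenvector, is at most the
spectral radius. -/
theorem le_specRad_of_eigenvector {V : Type*} [Fintype V] (G : SimpleGraph V) (μ : ℝ) (w : V → ℝ)
    (hw : w ≠ 0)
    (h : ∀ u, (letI := Classical.decRel G.Adj; ∑ v, if G.Adj u v then w v else 0) = μ * w u) :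
    μ ≤ specRad G := by
  classical
  unfold specRad
  refine le_csSup (Module.End.finite_hasEigenvalue _).bddAbove ?_
  refine Module.End.hasEigenvalue_of_hasEigenvector (x := w)
    ⟨Module.End.mem_eigenspace_iff.2 ?_, hw⟩
  funext u
  rw [Matrix.toLin'_apply, Pi.smul_apply, smul_eq_mul, ← h u]
  simp only [Matrix.mulVec, dotProduct, SimpleGraph.adjMatrix_apply, ite_mul, one_mul, zero_mul]

theorem kbipPlus_adj_iff (n a : ℕ) (u v : Fin n) :
    (KbipPlus n a).Adj u v ↔ (u : ℕ) ≠ v ∧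
      ((((u : ℕ) < a ∧ a ≤ (v : ℕ)) ∨ ((u : ℕ) = 0 ∧ (v : ℕ) = 1)) ∨
        (((v : ℕ) < a ∧ a ≤ (u : ℕ)) ∨ ((v : ℕ) = 0 ∧ (u : ℕ) = 1))) := by
  simp [KbipPlus, SimpleGraph.fromRel_adj, Fin.ext_iff]

/-- A root `r > 1` of the characteristic polynomial of the quotient matrix of `KbipPlus` is at most
its spectral radius. -/
theorem le_specRad_kbipPlus_of_root (k b : ℕ) (r : ℝ) (hr : 1 < r)
    (hroot : r ^ 3 - r ^ 2 - (2 + k) * b * r + k * b = 0) :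
    r ≤ specRad (KbipPlus (2 + k + b) (2 + k)) := by
  classical
  have hb : 0 < b := by
    rcases Nat.eq_zero_or_pos b with rfl | hb
    · exfalso
      have : 0 < r ^ 2 * (r - 1) := by have := sub_pos.2 hr; positivity
      push_cast at hroot
      nlinarith
    · exact hb
  let w : ℕ → ℝ := fun i =>
    if i < 2 then b * r else if i < 2 + k then b * (r - 1) else r * (r - 1)
  refine le_specRad_of_eigenvector _ r (fun i => w i) ?_ ?_
  · intro h
    have h0 := congrFun h ⟨0, by omega⟩
    have : (0 : ℝ) < b * r := by positivity
    simp [w] at h0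
    rcases h0 with h0 | h0
    · omega
    · linarith
  · intro u
    have hsum := Fin.sum_univ_eq_sum_range (fun i : ℕ => if (u : ℕ) ≠ i ∧
      ((((u : ℕ) < 2 + k ∧ 2 + k ≤ i) ∨ ((u : ℕ) = 0 ∧ i = 1)) ∨
        ((i < 2 + k ∧ 2 + k ≤ (u : ℕ)) ∨ (i = 0 ∧ (u : ℕ) = 1))) then w i else 0) (2 + k + b)
    simp only [kbipPlus_adj_iff]
    refine Eq.trans ?_ (hsum.trans ?_)
    · refine Finset.sum_congr rfl fun v _ => ?_
      congr
    rw [Finset.sum_range_add, Finset.sum_range_add, Finset.sum_range_succ, Finset.sum_range_one]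
    have hu := u.isLt
    generalize (u : ℕ) = m at hu ⊢
    by_cases hk : m < 2 + k
    · have hA : ∀ i ∈ Finset.range k, (if m ≠ 2 + i ∧ (((m < 2 + k ∧ 2 + k ≤ 2 + i) ∨
          (m = 0 ∧ 2 + i = 1)) ∨ ((2 + i < 2 + k ∧ 2 + k ≤ m) ∨ (2 + i = 0 ∧ m = 1)))
          then w (2 + i) else 0) = 0 := fun i hi => if_neg (by
            rw [Finset.mem_range] at hi; omega)
      have hB : ∀ i ∈ Finset.range b, (if m ≠ 2 + k + i ∧ (((m < 2 + k ∧ 2 + k ≤ 2 + k + i) ∨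
          (m = 0 ∧ 2 + k + i = 1)) ∨ ((2 + k + i < 2 + k ∧ 2 + k ≤ m) ∨
          (2 + k + i = 0 ∧ m = 1))) then w (2 + k + i) else 0) = r * (r - 1) := fun i hi => by
            rw [if_pos (by omega)]
            simp only [w]
            rw [if_neg (by omega), if_neg (by omega)]
      rw [Finset.sum_congr rfl hA, Finset.sum_congr rfl hB]
      by_cases h2 : m < 2
      · interval_cases m <;> simp [w] <;> ring
      rw [if_neg (by omega), if_neg (by omega)]
      have hm : w m = b * (r - 1) := by
        simp only [w]
        rw [if_neg h2, if_pos hk]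
      rw [hm]
      simp
      ring
    · have hA : ∀ i ∈ Finset.range k, (if m ≠ 2 + i ∧ (((m < 2 + k ∧ 2 + k ≤ 2 + i) ∨
          (m = 0 ∧ 2 + i = 1)) ∨ ((2 + i < 2 + k ∧ 2 + k ≤ m) ∨ (2 + i = 0 ∧ m = 1)))
          then w (2 + i) else 0) = b * (r - 1) := fun i hi => by
            rw [Finset.mem_range] at hi
            rw [if_pos (by omega)]
            simp only [w]
            rw [if_neg (by omega), if_pos (by omega)]
      have hB : ∀ i ∈ Finset.range b, (if m ≠ 2 + k + i ∧ (((m < 2 + k ∧ 2 + k ≤ 2 + k + i) ∨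
          (m = 0 ∧ 2 + k + i = 1)) ∨ ((2 + k + i < 2 + k ∧ 2 + k ≤ m) ∨
          (2 + k + i = 0 ∧ m = 1))) then w (2 + k + i) else 0) = 0 := fun i hi =>
            if_neg (by omega)
      rw [Finset.sum_congr rfl hA, Finset.sum_congr rfl hB, if_pos (by omega), if_pos (by omega)]
      have hm : w m = r * (r - 1) := by
        simp only [w]
        rw [if_neg (by omega), if_neg hk]
      rw [hm]
      simp [w]
      linear_combination -hroot

/-- If the characteristic polynomial of the quotient matrix of `KbipPlus` is negative at `t ≥ 1`,
then `t` is strictly below the spectral radius. -/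
theorem lt_specRad_kbipPlus (k b : ℕ) (t : ℝ) (ht : 1 ≤ t)
    (hneg : t ^ 3 - t ^ 2 - (2 + k) * b * t + k * b < 0) :
    t < specRad (KbipPlus (2 + k + b) (2 + k)) := by
  let f : ℝ → ℝ := fun x => x ^ 3 - x ^ 2 - (2 + k) * b * x + k * b
  have hk : (0 : ℝ) ≤ k := k.cast_nonneg
  have hb : (0 : ℝ) ≤ b := b.cast_nonneg
  have hc : (0 : ℝ) ≤ (2 + k) * b := by positivity
  set s : ℝ := t + (2 + k) * b + 1 with hs
  have hpos : 0 ≤ f s := by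
    have h1 : (2 + k) * b ≤ s * (s - 1) := by
      have : 0 ≤ (s - 1) * (s - 1) := mul_self_nonneg _
      nlinarith
    have h2 : 0 ≤ s * (s * (s - 1) - (2 + k) * b) :=
      mul_nonneg (by linarith) (by linarith)
    have h3 : 0 ≤ (k : ℝ) * b := by positivity
    simp only [f]
    nlinarith
  obtain ⟨r, ⟨hr, -⟩, hr0⟩ := intermediate_value_Icc (by linarith : t ≤ s)
    (by fun_prop : Continuous f).continuousOn ⟨hneg.le, hpos⟩
  have hne : t ≠ r := by
    rintro rfl
    exact hneg.ne hr0
  have hlt := lt_of_le_of_ne hr hne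
  exact hlt.trans_le (le_specRad_kbipPlus_of_root k b r (by linarith) hr0)

/-- If `n ≥ 4` is even then `λ(K⁺_{⌈n/2⌉,⌊n/2⌋}) > n/2 + 2/n`; if `n ≥ 5` is odd then
`λ(K⁺_{⌈n/2⌉,⌊n/2⌋}) > n/2 + 3/(2n)`. -/
theorem specRad_Kplus_lower_bound (n : ℕ) :
    (4 ≤ n → Even n → (n : ℝ) / 2 + 2 / (n : ℝ) < specRad (Kplus n)) ∧
      (5 ≤ n → Odd n → (n : ℝ) / 2 + 3 / (2 * (n : ℝ)) < specRad (Kplus n)) := by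
  constructor
  · intro hn he
    obtain ⟨k, rfl⟩ : ∃ k, n = 2 + k + (k + 2) := by
      obtain ⟨m, rfl⟩ := he
      exact ⟨m - 2, by omega⟩
    have hhalf : (2 + k + (k + 2) + 1) / 2 = 2 + k := by omega
    rw [Kplus, hhalf]
    have hk : (0 : ℝ) ≤ k := k.cast_nonneg
    have hx : (0 : ℝ) < k + 2 := by positivity
    have ht : ((2 + k + (k + 2) : ℕ) : ℝ) / 2 + 2 / ((2 + k + (k + 2) : ℕ) : ℝ)
        = (k + 2) + 1 / (k + 2) := by
      push_cast
      field_simp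
      ring
    rw [ht]
    apply lt_specRad_kbipPlus
    · have : (0 : ℝ) < 1 / (k + 2) := by positivity
      linarith
    · have key : ((k : ℝ) + 2 + 1 / (k + 2)) ^ 3 - ((k : ℝ) + 2 + 1 / (k + 2)) ^ 2
          - (2 + k) * ((k + 2 : ℕ) : ℝ) * ((k : ℝ) + 2 + 1 / (k + 2)) + k * ((k + 2 : ℕ) : ℝ)
          = -(2 * k ^ 3 + 9 * k ^ 2 + 13 * k + 5) / (k + 2) ^ 3 := by
        push_cast
        field_simp
        ring
      rw [key]
      apply div_neg_of_neg_of_pos _ (by positivity)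
      have : 0 ≤ (k : ℝ) ^ 3 := by positivity
      nlinarith
  · intro hn ho
    obtain ⟨k, rfl⟩ : ∃ k, n = 2 + (k + 1) + (k + 2) := by
      obtain ⟨m, rfl⟩ := ho
      exact ⟨m - 2, by omega⟩
    have hhalf : (2 + (k + 1) + (k + 2) + 1) / 2 = 2 + (k + 1) := by omega
    rw [Kplus, hhalf]
    have hk : (0 : ℝ) ≤ k := k.cast_nonneg
    obtain ⟨x, hx⟩ : ∃ x : ℝ, x = 2 * k + 5 := ⟨_, rfl⟩
    have hx5 : 5 ≤ x := by linarith
    have hx0 : 0 < x := by linarith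
    have hcast : ((2 + (k + 1) + (k + 2) : ℕ) : ℝ) = x := by
      push_cast
      linarith
    rw [hcast]
    apply lt_specRad_kbipPlus
    · have : 0 < 3 / (2 * x) := by positivity
      linarith
    · have hkx : (k : ℝ) = (x - 5) / 2 := by linarith
      have key : (x / 2 + 3 / (2 * x)) ^ 3 - (x / 2 + 3 / (2 * x)) ^ 2
          - (2 + ((k + 1 : ℕ) : ℝ)) * ((k + 2 : ℕ) : ℝ) * (x / 2 + 3 / (2 * x))
          + ((k + 1 : ℕ) : ℝ) * ((k + 2 : ℕ) : ℝ)
          = -(x ^ 4 + 6 * x ^ 3 - 30 * x ^ 2 + 18 * x - 27) / (8 * x ^ 3) := by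
        push_cast
        rw [hkx]
        field_simp
        ring
      rw [key]
      apply div_neg_of_neg_of_pos _ (by positivity)
      have h2 : 0 ≤ x ^ 3 * (x - 5) := mul_nonneg (by positivity) (by linarith)
      have h3 : 0 ≤ x ^ 2 * (x - 5) := mul_nonneg (by positivity) (by linarith)
      nlinarith [sq_nonneg x]
end
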